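/- Let T>0 and let (u,P) be a solution of the incompressible Euler equation on [0,T]×ℝ³ (as in the context) with vorticity ω = curl u, and assume 0 < sup_x|ω(0,x)| < ∞. Then for every point x_T ∈ ℝ³ there exists a solution (γ,ξ,b) of the bicharacteristic-amplitude system along u on [0,T] with |ξ(0)| = 1, |b(0)| = 1 and ⟨b(0),ξ(0)⟩ = 0, such that |b(T)|² · sup_{x∈ℝ³}|ω(0,x)| ≥ |ω(T,x_T)|. (This expresses sup_x √(|ω(T,x)|/‖ω⁰‖_{L^∞}) ≤ β(T), where β(T) is the supremum of |b(T)| over such solutions with unit orthogonal initial data.) -/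

import Mathlib

noncomputable section

open MeasureTheory Set
open scoped RealInnerProductSpace ENNReal

abbrev E3 := EuclideanSpace ℝ (Fin 3)

/-- The `i`-th standard basis vector of `ℝ³`. -/
def e3 (i : Fin 3) : E3 := EuclideanSpace.single i 1

/-- The spatial partial derivative `∂ⱼ fᵢ (x)`. -/
def pd3 (f : E3 → E3) (j i : Fin 3) (x : E3) : ℝ := fderiv ℝ f x (e3 j) i

/-- The curl of a vector field on `ℝ³`. -/
def curl3 (f : E3 → E3) (x : E3) : E3 :=
  (WithLp.equiv 2 (Fin 3 → ℝ)).symm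
    ![pd3 f 1 2 x - pd3 f 2 1 x, pd3 f 2 0 x - pd3 f 0 2 x, pd3 f 0 1 x - pd3 f 1 0 x]

/-- The divergence of a vector field on `ℝ³`. -/
def div3 (f : E3 → E3) (x : E3) : ℝ := ∑ i, pd3 f i i x

/-- The transpose of the spatial Jacobian of `f` at `x`, applied to `ξ`:
`(∂ₓf(x))ᵀ ξ`, where `(∂ₓf)_{ij} = ∂ⱼfᵢ`. -/
def jacT (f : E3 → E3) (x ξ : E3) : E3 :=
  (WithLp.equiv 2 (Fin 3 → ℝ)).symm (fun i => ⟪ξ, fderiv ℝ f x (e3 i)⟫)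

/-- The cross product on `ℝ³`. -/
def cross3 (a b : E3) : E3 :=
  (WithLp.equiv 2 (Fin 3 → ℝ)).symm
    ![a 1 * b 2 - a 2 * b 1, a 2 * b 0 - a 0 * b 2, a 0 * b 1 - a 1 * b 0]

/-- `(u, P)` is a solution of the incompressible Euler equation on `[0,T] × ℝ³`:
`u` is C¹ in time and C² in space, `u` and its first and second spatial derivatives are
continuous and bounded on `[0,T] × ℝ³`, and `∂ₜu + (u·∇)u + ∇P = 0`, `div u = 0` hold
pointwise on `[0,T] × ℝ³`. -/
structure IsEulerSolutionOn (u : ℝ → E3 → E3) (P : ℝ → E3 → ℝ) (T : ℝ) : Prop where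
  u_time_C1 : ∀ x, ContDiff ℝ 1 fun t => u t x
  u_space_C2 : ∀ t, ContDiff ℝ 2 (u t)
  cont_u : Continuous fun q : ℝ × E3 => u q.1 q.2
  cont_du : Continuous fun q : ℝ × E3 => fderiv ℝ (u q.1) q.2
  cont_d2u : Continuous fun q : ℝ × E3 => fderiv ℝ (fderiv ℝ (u q.1)) q.2
  bdd : ∃ C : ℝ, ∀ t ∈ Icc 0 T, ∀ x : E3, ‖u t x‖ ≤ C ∧ ‖fderiv ℝ (u t) x‖ ≤ C ∧
      ‖fderiv ℝ (fderiv ℝ (u t)) x‖ ≤ C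
  P_space_C1 : ∀ t, ContDiff ℝ 1 (P t)
  momentum : ∀ t ∈ Icc 0 T, ∀ x : E3,
      deriv (fun s => u s x) t + fderiv ℝ (u t) x (u t x) + gradient (P t) x = 0
  incompressible : ∀ t ∈ Icc 0 T, ∀ x : E3, div3 (u t) x = 0

/-- `(v, P')` is a solution of the linearization of the Euler equation about `u`
on `[0,T] × ℝ³`: `v` is C¹, `P'` is C¹ in space, and
`∂ₜv + (u·∇)v + (v·∇)u + ∇P' = 0`, `div v = 0` hold pointwise on `[0,T] × ℝ³`. -/
structure IsLinEulerSolutionOn (u v : ℝ → E3 → E3) (P' : ℝ → E3 → ℝ) (T : ℝ) : Prop where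
  v_C1 : ContDiff ℝ 1 fun q : ℝ × E3 => v q.1 q.2
  P'_space_C1 : ∀ t, ContDiff ℝ 1 (P' t)
  momentum : ∀ t ∈ Icc 0 T, ∀ x : E3,
      deriv (fun s => v s x) t + fderiv ℝ (v t) x (u t x) + fderiv ℝ (u t) x (v t x)
        + gradient (P' t) x = 0
  incompressible : ∀ t ∈ Icc 0 T, ∀ x : E3, div3 (v t) x = 0

/-- `(γ, ξ, b)` is a solution of the bicharacteristic-amplitude system along `u` on `[0,T]`:
`ξ(t) ≠ 0`, `γ' = u(t,γ)`, `ξ' = −(∂ₓu)ᵀξ`, and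
`b' = −(∂ₓu)b + 2 (⟨ξ, (∂ₓu)b⟩/|ξ|²) ξ` along `γ`. -/
structure IsBicharSolution (u : ℝ → E3 → E3) (T : ℝ) (γ ξ b : ℝ → E3) : Prop where
  xi_ne : ∀ t ∈ Icc 0 T, ξ t ≠ 0
  hgamma : ∀ t ∈ Icc 0 T, HasDerivAt γ (u t (γ t)) t
  hxi : ∀ t ∈ Icc 0 T, HasDerivAt ξ (-jacT (u t) (γ t) (ξ t)) t
  hb : ∀ t ∈ Icc 0 T, HasDerivAt b
      (-(fderiv ℝ (u t) (γ t) (b t)) +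
        (2 * ⟪ξ t, fderiv ℝ (u t) (γ t) (b t)⟫ / ‖ξ t‖ ^ 2) • ξ t) t


/-! ### ODE existence -/

/-- Coordinatewise truncation at level `R`. -/
def clampE (R : ℝ) (x : E3) : E3 := WithLp.toLp 2 (fun i => max (-R) (min R (x i)))

lemma clampE_lip (R : ℝ) : LipschitzWith 1 (clampE R) := by
  refine LipschitzWith.of_dist_le_mul fun x y => ?_
  rw [NNReal.coe_one, one_mul, EuclideanSpace.dist_eq, EuclideanSpace.dist_eq]
  apply Real.sqrt_le_sqrt
  apply Finset.sum_le_sum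
  intro i _
  apply pow_le_pow_left₀ dist_nonneg
  simp only [clampE, Real.dist_eq]
  rw [max_comm, max_comm (-R)]
  refine (abs_max_sub_max_le_abs _ _ _).trans ?_
  refine (abs_min_sub_min_le_max _ _ _ _).trans ?_
  simp

lemma clampE_eq {R : ℝ} {x : E3} (h : ‖x‖ ≤ R) : clampE R x = x := by
  ext i
  have h1 : |x i| ≤ R := by
    have := PiLp.norm_apply_le x i
    rw [Real.norm_eq_abs] at this
    linarith
  have := abs_le.1 h1
  simp only [clampE]
  rw [min_eq_right this.2, max_eq_right this.1]

lemma clampE_zero {R : ℝ} (hR : 0 ≤ R) : clampE R 0 = 0 :=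
  clampE_eq (by simpa using hR)

lemma clampE_norm_le {R : ℝ} (hR : 0 ≤ R) (x : E3) : ‖clampE R x‖ ≤ ‖x‖ := by
  have := (clampE_lip R).dist_le_mul x 0
  simpa [clampE_zero hR] using this

lemma clampE_norm_le' {R : ℝ} (hR : 0 ≤ R) (x : E3) : ‖clampE R x‖ ≤ 2 * R := by
  rw [EuclideanSpace.norm_eq]
  apply Real.sqrt_le_iff.2 ⟨by positivity, ?_⟩
  have : ∀ i, ‖clampE R x i‖ ^ 2 ≤ R ^ 2 := by
    intro i
    apply pow_le_pow_left₀ (norm_nonneg _)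
    simp only [clampE, Real.norm_eq_abs]
    rw [abs_le]
    exact ⟨le_max_left _ _, max_le (by linarith) (min_le_left _ _)⟩
  have h0 := this 0
  have h1 := this 1
  have h2 := this 2
  rw [Fin.sum_univ_three]
  nlinarith [sq_nonneg R]

/-- Global existence for a bounded, globally Lipschitz field. -/
lemma ode_bdd (T : ℝ) (hT : 0 < T) (f : ℝ → E3 → E3) (C K : NNReal)
    (hc : ∀ x, Continuous fun t => f t x) (hL : ∀ t, LipschitzWith K (f t))
    (hb : ∀ t x, ‖f t x‖ ≤ C) (t₀ : ℝ) (ht₀ : t₀ ∈ Icc 0 T) (x₀ : E3) :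
    ∃ x : ℝ → E3, x t₀ = x₀ ∧ ∀ t ∈ Icc 0 T, HasDerivAt x (f t (x t)) t := by
  have ht' : t₀ ∈ Icc (-1) (T + 1) := ⟨by linarith [ht₀.1], by linarith [ht₀.2]⟩
  have hP : IsPicardLindelof f (⟨t₀, ht'⟩ : Icc (-1 : ℝ) (T + 1)) x₀
      (C * Real.toNNReal (T + 2)) 0 C K := by
    refine ⟨fun t _ => (hL t).lipschitzOnWith, fun x _ => (hc x).continuousOn,
      fun t _ x _ => hb t x, ?_⟩
    push_cast
    rw [Real.coe_toNNReal _ (by linarith), sub_zero]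
    apply mul_le_mul_of_nonneg_left _ C.2
    apply max_le <;> simp <;> linarith [ht₀.1, ht₀.2]
  obtain ⟨x, hx, hd⟩ := hP.exists_eq_forall_mem_Icc_hasDerivWithinAt₀
  refine ⟨x, hx, fun t ht => (hd t ⟨by linarith [ht.1], by linarith [ht.2]⟩).hasDerivAt ?_⟩
  exact Icc_mem_nhds (by linarith [ht.1]) (by linarith [ht.2])

/-- Forward global existence for linear equations. -/
lemma ode_lin (T : ℝ) (hT : 0 < T) (M : ℝ → E3 →L[ℝ] E3) (hM : Continuous M) (C : NNReal)
    (hb : ∀ t, ‖M t‖ ≤ C) (x₀ : E3) :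
    ∃ x : ℝ → E3, x 0 = x₀ ∧ ∀ t ∈ Icc 0 T, HasDerivAt x (M t (x t)) t := by
  set R : ℝ := ‖x₀‖ * Real.exp (C * T) with hRdef
  have hR : 0 ≤ R := by positivity
  obtain ⟨x, hx, hd⟩ := ode_bdd T hT (fun t x => M t (clampE R x)) (C * (2 * ⟨R, hR⟩)) C
    (fun x => by fun_prop)
    (fun t => by
      have h1 : LipschitzWith C (M t) := (M t).lipschitz.weaken (by exact_mod_cast hb t)
      have h2 := h1.comp (clampE_lip R)
      rw [mul_one] at h2
      exact h2)
    (fun t x => by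
      refine ((M t).le_opNorm _).trans ?_
      push_cast
      exact mul_le_mul (hb t) (clampE_norm_le' hR x) (norm_nonneg _) C.2)
    0 ⟨le_rfl, hT.le⟩ x₀
  refine ⟨x, hx, fun t ht => ?_⟩
  have hg := norm_le_gronwallBound_of_norm_deriv_right_le (f := x)
    (f' := fun t => M t (clampE R (x t))) (δ := ‖x₀‖) (K := C) (ε := 0) (a := 0) (b := T)
    (fun s hs => (hd s hs).continuousAt.continuousWithinAt)
    (fun s hs => (hd s ⟨hs.1, hs.2.le⟩).hasDerivWithinAt) (by rw [hx])
    (fun s _ => by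
      rw [add_zero]
      refine ((M s).le_opNorm _).trans ?_
      exact mul_le_mul (hb s) (clampE_norm_le hR _) (norm_nonneg _) C.2) t ht
  rw [gronwallBound_ε0, sub_zero] at hg
  have h2 : ‖x t‖ ≤ R := hg.trans (by
    rw [hRdef]
    gcongr
    exact ht.2)
  have := hd t ht
  simp only [clampE_eq h2] at this
  exact this

/-- A solution of a linear equation vanishing at `0` vanishes on `[0,T]`. -/
lemma ode_lin_zero (T : ℝ) (M : ℝ → E3 →L[ℝ] E3) (C : NNReal)
    (hb : ∀ t, ‖M t‖ ≤ C) (x : ℝ → E3) (hd : ∀ t ∈ Icc 0 T, HasDerivAt x (M t (x t)) t)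
    (h0 : x 0 = 0) : ∀ t ∈ Icc 0 T, x t = 0 := by
  intro t ht
  have hg := norm_le_gronwallBound_of_norm_deriv_right_le (f := x)
    (f' := fun t => M t (x t)) (δ := 0) (K := C) (ε := 0) (a := 0) (b := T)
    (fun s hs => (hd s hs).continuousAt.continuousWithinAt)
    (fun s hs => (hd s ⟨hs.1, hs.2.le⟩).hasDerivWithinAt) (by simp [h0])
    (fun s _ => by
      rw [add_zero]
      refine ((M s).le_opNorm _).trans ?_
      exact mul_le_mul_of_nonneg_right (hb s) (norm_nonneg _)) t ht
  simpa [gronwallBound_ε0] using hg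

/-- Backward solution of a linear equation: nonzero everywhere if nonzero at the end. -/
lemma ode_lin_back (T : ℝ) (hT : 0 < T) (M : ℝ → E3 →L[ℝ] E3) (hM : Continuous M) (C : NNReal)
    (hb : ∀ t, ‖M t‖ ≤ C) (x₁ : E3) (hx₁ : x₁ ≠ 0) :
    ∃ x : ℝ → E3, x T = x₁ ∧ (∀ t ∈ Icc 0 T, HasDerivAt x (M t (x t)) t) ∧
      ∀ t ∈ Icc 0 T, x t ≠ 0 := by
  obtain ⟨y, hy, hd⟩ := ode_lin T hT (fun s => -M (T - s)) (by fun_prop) C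
    (fun t => by simpa using hb _) x₁
  have hD : ∀ t ∈ Icc 0 T, HasDerivAt (fun t => y (T - t)) (M t (y (T - t))) t := by
    intro t ht
    have h1 := hd (T - t) ⟨by linarith [ht.2], by linarith [ht.1]⟩
    have h2 : HasDerivAt (fun t : ℝ => T - t) (-1) t := (hasDerivAt_id t).const_sub T
    have := h1.scomp t h2
    simpa [Function.comp_def] using this
  refine ⟨fun t => y (T - t), by simpa using hy, hD, fun t ht h0 => ?_⟩
  have hz := ode_lin_zero (T - t) (fun s => M (t + s)) C (fun s => hb _)
    (fun s => y (T - (t + s))) (fun s hs => by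
      have h1 := hD (t + s) ⟨by linarith [hs.1, ht.1], by linarith [hs.2]⟩
      have h2 : HasDerivAt (fun s : ℝ => t + s) 1 s := (hasDerivAt_id s).const_add t
      have := h1.scomp s h2
      simpa [Function.comp_def] using this) (by simpa using h0) (T - t)
      ⟨by linarith [ht.2], le_rfl⟩
  simp only [add_sub_cancel, sub_self] at hz
  exact hx₁ (hy ▸ hz)

/-! ### The vorticity equation in integrated form -/

/-- The convection term. -/
def NN (u : ℝ → E3 → E3) (s : ℝ) (x : E3) : E3 := fderiv ℝ (u s) x (u s x)

/-- The spatial derivative of the convection term. -/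
def DN (u : ℝ → E3 → E3) (s : ℝ) (x : E3) : E3 →L[ℝ] E3 :=
  (fderiv ℝ (u s) x).comp (fderiv ℝ (u s) x) + (fderiv ℝ (fderiv ℝ (u s)) x).flip (u s x)

/-- Time integral of the (negative) pressure gradient. -/
def WW (u : ℝ → E3 → E3) (t : ℝ) (x : E3) : E3 := u t x - u 0 x + ∫ s in (0:ℝ)..t, NN u s x

/-- Spatial derivative of `WW`. -/
def SS (u : ℝ → E3 → E3) (t : ℝ) (x : E3) : E3 →L[ℝ] E3 :=
  fderiv ℝ (u t) x - fderiv ℝ (u 0) x + ∫ s in (0:ℝ)..t, DN u s x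

/-- Negative pressure gradient. -/
def gg (u : ℝ → E3 → E3) (s : ℝ) (x : E3) : E3 := deriv (fun r => u r x) s + NN u s x

section
variable {u : ℝ → E3 → E3} {P : ℝ → E3 → ℝ} {T : ℝ}

lemma cont_NN (hu : IsEulerSolutionOn u P T) : Continuous fun q : ℝ × E3 => NN u q.1 q.2 :=
  hu.cont_du.clm_apply hu.cont_u

lemma cont_DN (hu : IsEulerSolutionOn u P T) : Continuous fun q : ℝ × E3 => DN u q.1 q.2 := by
  unfold DN
  have h1 := hu.cont_du
  have h2 := hu.cont_d2u
  have h3 := hu.cont_u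
  have h4 : Continuous fun q : ℝ × E3 => (fderiv ℝ (fderiv ℝ (u q.1)) q.2).flip :=
    (ContinuousLinearMap.flipₗᵢ ℝ E3 E3 E3).continuous.comp h2
  exact (h1.clm_comp h1).add (h4.clm_apply h3)

lemma diff_u (hu : IsEulerSolutionOn u P T) (t : ℝ) (x : E3) :
    HasFDerivAt (u t) (fderiv ℝ (u t) x) x :=
  (((hu.u_space_C2 t).differentiable (by norm_num)) x).hasFDerivAt

lemma diff_du (hu : IsEulerSolutionOn u P T) (t : ℝ) (x : E3) :
    HasFDerivAt (fderiv ℝ (u t)) (fderiv ℝ (fderiv ℝ (u t)) x) x :=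
  ((((hu.u_space_C2 t).fderiv_right (m := 1) (by norm_num)).differentiable (by norm_num)) x).hasFDerivAt

lemma hasFDerivAt_NN (hu : IsEulerSolutionOn u P T) (t : ℝ) (x : E3) :
    HasFDerivAt (NN u t) (DN u t x) x :=
  (diff_du hu t x).clm_apply (diff_u hu t x)

lemma bdd_DN (hu : IsEulerSolutionOn u P T) :
    ∃ C : ℝ, ∀ t ∈ Icc 0 T, ∀ x, ‖DN u t x‖ ≤ C := by
  obtain ⟨C, hC⟩ := hu.bdd
  refine ⟨C * C + C * C, fun t ht x => ?_⟩
  obtain ⟨h1, h2, h3⟩ := hC t ht x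
  have hC0 : 0 ≤ C := (norm_nonneg _).trans h1
  unfold DN
  refine (norm_add_le _ _).trans (add_le_add ?_ ?_)
  · exact (ContinuousLinearMap.opNorm_comp_le _ _).trans (mul_le_mul h2 h2 (norm_nonneg _) hC0)
  · refine (ContinuousLinearMap.le_opNorm _ _).trans ?_
    rw [ContinuousLinearMap.opNorm_flip]
    exact mul_le_mul h3 h1 (norm_nonneg _) hC0

lemma uIoc_sub {t s : ℝ} (ht : t ∈ Icc 0 T) (hs : s ∈ uIoc 0 t) : s ∈ Icc 0 T := by
  rw [uIoc_of_le ht.1] at hs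
  exact ⟨hs.1.le, hs.2.trans ht.2⟩

lemma hasFDerivAt_WW (hu : IsEulerSolutionOn u P T) {t : ℝ} (ht : t ∈ Icc 0 T) (x : E3) :
    HasFDerivAt (WW u t) (SS u t x) x := by
  obtain ⟨C, hC⟩ := bdd_DN hu
  have hcN := cont_NN hu
  have hcD := cont_DN hu
  have hN : ∀ y, Continuous fun s => NN u s y := fun y =>
    hcN.comp (Continuous.prodMk continuous_id continuous_const)
  have hD : ∀ y, Continuous fun s => DN u s y := fun y =>
    hcD.comp (Continuous.prodMk continuous_id continuous_const)
  have hI := intervalIntegral.hasFDerivAt_integral_of_dominated_of_fderiv_le (𝕜 := ℝ)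
    (μ := volume) (a := 0) (b := t) (F := fun y s => NN u s y) (F' := fun y s => DN u s y)
    (x₀ := x) (s := univ) (bound := fun _ => C) Filter.univ_mem
    (Filter.Eventually.of_forall fun y => (hN y).aestronglyMeasurable)
    ((hN x).intervalIntegrable _ _) (hD x).aestronglyMeasurable
    (Filter.Eventually.of_forall fun s hs y _ => hC s (uIoc_sub ht hs) y)
    (by simp)
    (Filter.Eventually.of_forall fun s hs y _ => hasFDerivAt_NN hu s y)
  exact ((diff_u hu t x).sub (diff_u hu 0 x)).add hI

lemma cont_SS (hu : IsEulerSolutionOn u P T) (t : ℝ) : Continuous (SS u t) := by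
  have h1 : ∀ t, Continuous (fderiv ℝ (u t)) := fun t =>
    hu.cont_du.comp (Continuous.prodMk continuous_const continuous_id)
  have hcD := cont_DN hu
  refine ((h1 t).sub (h1 0)).add ?_
  exact intervalIntegral.continuous_parametric_intervalIntegral_of_continuous'
    (f := fun y s => DN u s y) (hcD.comp continuous_swap) 0 t

lemma cont_gg_time (hu : IsEulerSolutionOn u P T) (x : E3) : Continuous fun s => gg u s x :=
  ((hu.u_time_C1 x).continuous_deriv le_rfl).add
    ((cont_NN hu).comp (Continuous.prodMk continuous_id continuous_const))

lemma gg_eq (hu : IsEulerSolutionOn u P T) {s : ℝ} (hs : s ∈ Icc 0 T) (x : E3) :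
    gg u s x = - gradient (P s) x :=
  eq_neg_of_add_eq_zero_left (hu.momentum s hs x)

lemma cont_gg_space (hu : IsEulerSolutionOn u P T) {s : ℝ} (hs : s ∈ Icc 0 T) :
    Continuous (gg u s) := by
  have : gg u s = fun x => - gradient (P s) x := funext fun x => gg_eq hu hs x
  rw [this]
  refine Continuous.neg ?_
  exact (LinearIsometryEquiv.continuous _).comp ((hu.P_space_C1 s).continuous_fderiv (by norm_num))

lemma hasFDerivAt_P (hu : IsEulerSolutionOn u P T) {s : ℝ} (hs : s ∈ Icc 0 T) (x : E3) :
    HasFDerivAt (P s) (-innerSL ℝ (gg u s x)) x := by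
  have h1 : DifferentiableAt ℝ (P s) x := (hu.P_space_C1 s).differentiable (by norm_num) x
  have h2 := h1.hasGradientAt.hasFDerivAt
  have h3 : -innerSL ℝ (gg u s x) = InnerProductSpace.toDual ℝ E3 (gradient (P s) x) := by
    ext v
    simp [gg_eq hu hs]
  rw [h3]
  exact h2

lemma WW_eq (hu : IsEulerSolutionOn u P T) (t : ℝ) (x : E3) :
    WW u t x = ∫ s in (0:ℝ)..t, gg u s x := by
  have hN : Continuous fun s => NN u s x :=
    (cont_NN hu).comp (Continuous.prodMk continuous_id continuous_const)
  have hd := (hu.u_time_C1 x).continuous_deriv le_rfl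
  unfold gg WW
  rw [intervalIntegral.integral_add (hd.intervalIntegrable _ _) (hN.intervalIntegrable _ _),
    intervalIntegral.integral_deriv_eq_sub
      (fun s _ => (hu.u_time_C1 x).differentiable (by norm_num) s) (hd.intervalIntegrable _ _)]

lemma SS_symm_local (hu : IsEulerSolutionOn u P T) {t : ℝ} (ht : t ∈ Icc 0 T) (x₀ : E3) (n : ℝ)
    (hn : x₀ ∈ interior {x | ∀ s ∈ Icc 0 T, ‖gg u s x‖ ≤ n}) (h k : E3) :
    ⟪SS u t x₀ h, k⟫ = ⟪SS u t x₀ k, h⟫ := by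
  have hT : 0 ≤ T := ht.1.trans ht.2
  obtain ⟨r, hr, hball⟩ := Metric.isOpen_iff.1 isOpen_interior x₀ hn
  replace hball := hball.trans interior_subset
  set cl : ℝ → ℝ := fun s => (projIcc 0 T hT s : ℝ) with hcl
  have hclc : Continuous cl := continuous_subtype_val.comp continuous_projIcc
  have hclm : ∀ s, cl s ∈ Icc 0 T := fun s => (projIcc 0 T hT s).2
  have hcle : ∀ s ∈ Icc 0 T, cl s = s := fun s hs => by simp [hcl, projIcc_of_mem hT hs]
  -- continuity in time of the normalised pressure
  have hPc : ∀ x ∈ Metric.ball x₀ r, Continuous fun s => P (cl s) x₀ - P (cl s) x := by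
    intro x hx
    have hseg : ∀ θ ∈ Icc (0:ℝ) 1, x₀ + θ • (x - x₀) ∈ Metric.ball x₀ r := by
      intro θ hθ
      rw [Metric.mem_ball, dist_eq_norm] at hx ⊢
      rw [add_sub_cancel_left, norm_smul, Real.norm_eq_abs, abs_of_nonneg hθ.1]
      refine lt_of_le_of_lt ?_ hx
      exact mul_le_of_le_one_left (norm_nonneg _) hθ.2
    have hcont : ∀ s, Continuous fun θ : ℝ => ⟪gg u (cl s) (x₀ + θ • (x - x₀)), x - x₀⟫ := by
      intro s
      have := cont_gg_space hu (hclm s)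
      exact Continuous.inner (this.comp (by fun_prop)) continuous_const
    have heq : (fun s => P (cl s) x₀ - P (cl s) x) =
        fun s => ∫ θ in (0:ℝ)..1, ⟪gg u (cl s) (x₀ + θ • (x - x₀)), x - x₀⟫ := by
      funext s
      have hder : ∀ θ ∈ uIcc (0:ℝ) 1, HasDerivAt (fun θ : ℝ => -P (cl s) (x₀ + θ • (x - x₀)))
          ⟪gg u (cl s) (x₀ + θ • (x - x₀)), x - x₀⟫ θ := by
        intro θ _
        have h1 := hasFDerivAt_P hu (hclm s) (x₀ + θ • (x - x₀))
        have h2 : HasDerivAt (fun θ : ℝ => x₀ + θ • (x - x₀)) (x - x₀) θ := by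
          simpa using ((hasDerivAt_id θ).smul_const (x - x₀)).const_add x₀
        have h3 := (h1.comp_hasDerivAt θ h2).neg
        exact h3.congr_deriv (by simp)
      rw [intervalIntegral.integral_eq_sub_of_hasDerivAt hder ((hcont s).intervalIntegrable _ _)]
      simp
      ring
    rw [heq]
    refine intervalIntegral.continuous_of_dominated_interval (bound := fun _ => n * ‖x - x₀‖)
      (fun s => (hcont s).aestronglyMeasurable) ?_ (by simp) ?_
    · refine fun s => Filter.Eventually.of_forall fun θ hθ => ?_
      rw [uIoc_of_le zero_le_one] at hθ
      refine (norm_inner_le_norm _ _).trans ?_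
      exact mul_le_mul_of_nonneg_right (hball (hseg θ ⟨hθ.1.le, hθ.2⟩) _ (hclm s)) (norm_nonneg _)
    · refine Filter.Eventually.of_forall fun θ hθ => ?_
      exact Continuous.inner ((cont_gg_time hu _).comp hclc) continuous_const
  have hW : ∀ x, ∫ s in (0:ℝ)..t, innerSL ℝ (gg u (cl s) x) = innerSL ℝ (WW u t x) := by
    intro x
    rw [WW_eq hu]
    have h1 : ∫ s in (0:ℝ)..t, gg u s x = ∫ s in (0:ℝ)..t, gg u (cl s) x := by
      refine intervalIntegral.integral_congr fun s hs => ?_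
      rw [uIcc_of_le ht.1] at hs
      simp only [hcle s ⟨hs.1, hs.2.trans ht.2⟩]
    rw [h1]
    exact (innerSL ℝ).intervalIntegral_comp_comm
      (((cont_gg_time hu x).comp hclc).intervalIntegrable _ _)
  have hQ : ∀ x ∈ Metric.ball x₀ r,
      HasFDerivAt (fun x => ∫ s in (0:ℝ)..t, (P (cl s) x₀ - P (cl s) x))
        (innerSL ℝ (WW u t x)) x := by
    intro x hx
    have hb : Metric.ball x₀ r ∈ nhds x := Metric.isOpen_ball.mem_nhds hx
    rw [← hW]
    refine intervalIntegral.hasFDerivAt_integral_of_dominated_of_fderiv_le (𝕜 := ℝ)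
      (F' := fun x s => innerSL ℝ (gg u (cl s) x)) (s := Metric.ball x₀ r)
      (bound := fun _ => n) hb ?_ ((hPc x hx).intervalIntegrable _ _) ?_ ?_ (by simp) ?_
    · exact Filter.eventually_of_mem hb fun y hy => (hPc y hy).aestronglyMeasurable
    · exact ((innerSL ℝ).continuous.comp ((cont_gg_time hu x).comp hclc)).aestronglyMeasurable
    · refine Filter.Eventually.of_forall fun s _ y hy => ?_
      rw [innerSL_apply_norm]
      exact hball hy _ (hclm s)
    · refine Filter.Eventually.of_forall fun s _ y hy => ?_
      simpa using (hasFDerivAt_P hu (hclm s) y).const_sub (P (cl s) x₀)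
  have h2 : HasFDerivAt (fun x => innerSL ℝ (WW u t x)) ((innerSL ℝ).comp (SS u t x₀)) x₀ :=
    (innerSL ℝ).hasFDerivAt.comp x₀ (hasFDerivAt_WW hu ht x₀)
  have := second_derivative_symmetric_of_eventually (𝕜 := ℝ)
    (Filter.eventually_of_mem (Metric.ball_mem_nhds x₀ hr) hQ) h2 h k
  simpa using this

lemma SS_symm (hu : IsEulerSolutionOn u P T) {t : ℝ} (ht : t ∈ Icc 0 T) (x h k : E3) :
    ⟪SS u t x h, k⟫ = ⟪SS u t x k, h⟫ := by
  have hcl : IsClosed {x | ⟪SS u t x h, k⟫ = ⟪SS u t x k, h⟫} := by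
    have := cont_SS hu t
    exact isClosed_eq (by fun_prop) (by fun_prop)
  have hc : ∀ n : ℕ, IsClosed {x | ∀ s ∈ Icc 0 T, ‖gg u s x‖ ≤ n} := by
    intro n
    have : {x | ∀ s ∈ Icc 0 T, ‖gg u s x‖ ≤ n} = ⋂ s ∈ Icc 0 T, {x | ‖gg u s x‖ ≤ n} := by
      ext; simp
    rw [this]
    refine isClosed_biInter fun s hs => ?_
    exact isClosed_le (cont_gg_space hu hs).norm continuous_const
  have hU : ⋃ n : ℕ, {x | ∀ s ∈ Icc 0 T, ‖gg u s x‖ ≤ n} = univ := by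
    refine eq_univ_of_forall fun x => ?_
    obtain ⟨C, hC⟩ := isCompact_Icc.exists_bound_of_continuousOn
      (cont_gg_time hu x).continuousOn (s := Icc 0 T)
    obtain ⟨n, hn⟩ := exists_nat_ge C
    exact mem_iUnion.2 ⟨n, fun s hs => (hC s hs).trans hn⟩
  have hd := dense_iUnion_interior_of_closed hc hU
  have hsub : (⋃ n : ℕ, interior {x | ∀ s ∈ Icc 0 T, ‖gg u s x‖ ≤ n}) ⊆
      {x | ⟪SS u t x h, k⟫ = ⟪SS u t x k, h⟫} := by
    intro y hy
    obtain ⟨n, hn⟩ := mem_iUnion.1 hy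
    exact SS_symm_local hu ht y n hn h k
  exact hcl.closure_subset_iff.2 hsub (hd x)

/-- Vorticity form along a particle path. -/
lemma vort_deriv (hu : IsEulerSolutionOn u P T) (γ : ℝ → E3) {t : ℝ} (ht : t ∈ Ioo 0 T)
    (hγ : HasDerivAt γ (u t (γ t)) t) (h k : E3) :
    HasDerivAt (fun t => ⟪fderiv ℝ (u t) (γ t) h, k⟫ - ⟪fderiv ℝ (u t) (γ t) k, h⟫)
      (-(⟪fderiv ℝ (u t) (γ t) (fderiv ℝ (u t) (γ t) h), k⟫
        - ⟪fderiv ℝ (u t) (γ t) (fderiv ℝ (u t) (γ t) k), h⟫)) t := by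
  -- the linear functional `A ↦ ⟪A h, k⟫ - ⟪A k, h⟫`
  let Λ : (E3 →L[ℝ] E3) →L[ℝ] ℝ :=
    (innerSL ℝ k).comp (ContinuousLinearMap.apply ℝ E3 h) -
      (innerSL ℝ h).comp (ContinuousLinearMap.apply ℝ E3 k)
  have hΛ : ∀ A, Λ A = ⟪A h, k⟫ - ⟪A k, h⟫ := by
    intro A
    simp [Λ, real_inner_comm]
  have hform : ∀ s ∈ Icc 0 T, ∀ x, Λ (fderiv ℝ (u s) x) =
      Λ (fderiv ℝ (u 0) x) - ∫ r in (0:ℝ)..s, Λ (DN u r x) := by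
    intro s hs x
    have hD : Continuous fun s => DN u s x :=
      (cont_DN hu).comp (Continuous.prodMk continuous_id continuous_const)
    have h1 : Λ (SS u s x) = 0 := by rw [hΛ, SS_symm hu hs x h k, sub_self]
    rw [Λ.intervalIntegral_comp_comm (hD.intervalIntegrable _ _)]
    unfold SS at h1
    rw [map_add, map_sub] at h1
    linarith
  have hderiv_t : ∀ s ∈ Ioo 0 T, ∀ x, HasDerivAt (fun s => Λ (fderiv ℝ (u s) x))
      (-Λ (DN u s x)) s := by
    intro s hs x
    have hD : Continuous fun s => Λ (DN u s x) :=
      Λ.continuous.comp ((cont_DN hu).comp (Continuous.prodMk continuous_id continuous_const))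
    have h1 : HasDerivAt (fun s => Λ (fderiv ℝ (u 0) x) - ∫ r in (0:ℝ)..s, Λ (DN u r x))
        (-Λ (DN u s x)) s := (hD.integral_hasStrictDerivAt 0 s).hasDerivAt.const_sub _
    refine h1.congr_of_eventuallyEq ?_
    filter_upwards [Ioo_mem_nhds hs.1 hs.2] with r hr
    exact hform r ⟨hr.1.le, hr.2.le⟩ x
  have hmem : ∀ᶠ v : ℝ × E3 in nhds (t, γ t), v.1 ∈ Ioo 0 T :=
    continuous_fst.continuousAt.eventually (Ioo_mem_nhds ht.1 ht.2)
  have hs := hasStrictFDerivAt_uncurry_coprod (𝕜 := ℝ) (u := (t, γ t))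
    (f := fun s x => Λ (fderiv ℝ (u s) x))
    (f₁ := fun s x => ContinuousLinearMap.toSpanSingleton ℝ (-Λ (DN u s x)))
    (f₂ := fun s x => Λ.comp (fderiv ℝ (fderiv ℝ (u s)) x))
    (hmem.mono fun v hv => (hderiv_t v.1 hv v.2).hasFDerivAt)
    (Filter.Eventually.of_forall fun v => Λ.hasFDerivAt.comp v.2 (diff_du hu v.1 v.2))
    (by
      have := cont_DN hu
      have h3 : Continuous fun q : ℝ × E3 =>
          ContinuousLinearMap.toSpanSingleton ℝ (-Λ (DN u q.1 q.2)) :=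
        (ContinuousLinearMap.toSpanSingletonCLE (𝕜 := ℝ) (E := ℝ)).continuous.comp
          (Λ.continuous.comp this).neg
      exact h3.continuousAt)
    (by
      have h3 : Continuous fun q : ℝ × E3 => Λ.comp (fderiv ℝ (fderiv ℝ (u q.1)) q.2) :=
        continuous_const.clm_comp hu.cont_d2u
      exact h3.continuousAt)
  have hcurve : HasDerivAt (fun s => (s, γ s)) ((1 : ℝ), u t (γ t)) t :=
    (hasDerivAt_id t).prodMk hγ
  have hfin := HasFDerivAt.comp_hasDerivAt t (f := fun s => (s, γ s)) hs.hasFDerivAt hcurve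
  have hsym : ∀ v w : E3, fderiv ℝ (fderiv ℝ (u t)) (γ t) v w =
      fderiv ℝ (fderiv ℝ (u t)) (γ t) w v := fun v w =>
    second_derivative_symmetric (𝕜 := ℝ) (fun y => diff_u hu t y) (diff_du hu t (γ t)) v w
  refine (hfin.congr_deriv ?_).congr_of_eventuallyEq ?_
  · simp only [Function.HasUncurry.uncurry, id, ContinuousLinearMap.coprod_apply,
      ContinuousLinearMap.toSpanSingleton_apply, ContinuousLinearMap.comp_apply, hΛ, DN,
      add_apply, ContinuousLinearMap.flip_apply, inner_add_left, one_smul,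
      hsym (u t (γ t))]
    ring
  · exact Filter.Eventually.of_forall fun s => (hΛ _).symm
end

/-! ### Algebra in coordinates -/

lemma inner3 (a b : E3) : ⟪a, b⟫ = a 0 * b 0 + a 1 * b 1 + a 2 * b 2 := by
  simp [PiLp.inner_apply, Fin.sum_univ_three, mul_comm]

lemma inner_e3 (a : E3) (i : Fin 3) : ⟪a, e3 i⟫ = a i := by
  simp [e3, EuclideanSpace.inner_single_right]

lemma normsq3 (a : E3) : ‖a‖ ^ 2 = a 0 * a 0 + a 1 * a 1 + a 2 * a 2 := by
  rw [← real_inner_self_eq_norm_sq, inner3]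

lemma clm3 (A : E3 →L[ℝ] E3) (v : E3) (i : Fin 3) :
    A v i = A (e3 0) i * v 0 + A (e3 1) i * v 1 + A (e3 2) i * v 2 := by
  have h : v = v 0 • e3 0 + v 1 • e3 1 + v 2 • e3 2 := by
    ext j
    fin_cases j <;> simp [e3]
  conv_lhs => rw [h]
  simp only [map_add, map_smul, PiLp.add_apply, PiLp.smul_apply, smul_eq_mul]
  ring

lemma jacT3 (f : E3 → E3) (x ξ : E3) (i : Fin 3) : jacT f x ξ i =
    ξ 0 * fderiv ℝ f x (e3 i) 0 + ξ 1 * fderiv ℝ f x (e3 i) 1 + ξ 2 * fderiv ℝ f x (e3 i) 2 := by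
  simp [jacT, inner3]

lemma jacT_adj (f : E3 → E3) (x ξ : E3) :
    jacT f x ξ = ContinuousLinearMap.adjoint (fderiv ℝ f x) ξ := by
  ext i
  rw [← inner_e3, ← inner_e3 (ContinuousLinearMap.adjoint _ ξ),
    ContinuousLinearMap.adjoint_inner_left, inner_e3, jacT3, inner3]

lemma cross3_0 (a b : E3) : cross3 a b 0 = a 1 * b 2 - a 2 * b 1 := by simp [cross3]
lemma cross3_1 (a b : E3) : cross3 a b 1 = a 2 * b 0 - a 0 * b 2 := by simp [cross3]
lemma cross3_2 (a b : E3) : cross3 a b 2 = a 0 * b 1 - a 1 * b 0 := by simp [cross3]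

lemma curl3_0 (f : E3 → E3) (x : E3) : curl3 f x 0 =
    ⟪fderiv ℝ f x (e3 1), e3 2⟫ - ⟪fderiv ℝ f x (e3 2), e3 1⟫ := by
  simp only [inner_e3]; simp [curl3, pd3]
lemma curl3_1 (f : E3 → E3) (x : E3) : curl3 f x 1 =
    ⟪fderiv ℝ f x (e3 2), e3 0⟫ - ⟪fderiv ℝ f x (e3 0), e3 2⟫ := by
  simp only [inner_e3]; simp [curl3, pd3]
lemma curl3_2 (f : E3 → E3) (x : E3) : curl3 f x 2 =
    ⟪fderiv ℝ f x (e3 0), e3 1⟫ - ⟪fderiv ℝ f x (e3 1), e3 0⟫ := by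
  simp only [inner_e3]; simp [curl3, pd3]

lemma hasDerivAt_coord {f : ℝ → E3} {f' : E3} {t : ℝ} (h : HasDerivAt f f' t) (i : Fin 3) :
    HasDerivAt (fun s => f s i) (f' i) t :=
  (EuclideanSpace.proj (𝕜 := ℝ) i).hasFDerivAt.comp_hasDerivAt t h

lemma const_of_deriv_zero {f : ℝ → ℝ} {T : ℝ} (hT : 0 < T) (hc : ContinuousOn f (Icc 0 T))
    (hd : ∀ t ∈ Ioo 0 T, HasDerivAt f 0 t) : f T = f 0 := by
  obtain ⟨c, _, h⟩ := exists_hasDerivAt_eq_slope f (fun _ => 0) hT hc hd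
  have : (f T - f 0) = 0 := by
    rw [eq_comm, div_eq_zero_iff] at h
    rcases h with h | h
    · exact h
    · linarith
  linarith

lemma norm_cross_le (a b : E3) : ‖cross3 a b‖ ≤ ‖a‖ * ‖b‖ := by
  apply abs_le_of_sq_le_sq' _ (by positivity) |>.2
  rw [mul_pow, normsq3, normsq3, normsq3, cross3_0, cross3_1, cross3_2]
  nlinarith [sq_nonneg (a 0 * b 0 + a 1 * b 1 + a 2 * b 2)]

lemma exists_perp (x : E3) (hx : ‖x‖ = 1) : ∃ p : E3, ‖p‖ = 1 ∧ ⟪p, x⟫ = 0 := by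
  have hd : 0 < Module.finrank ℝ (ℝ ∙ x)ᗮ := by
    have h1 := Submodule.finrank_add_finrank_orthogonal (ℝ ∙ x)
    have h2 := finrank_span_singleton (K := ℝ) (v := x) (by rintro rfl; simp at hx)
    have h3 : Module.finrank ℝ E3 = 3 := by simp
    omega
  have := Module.nontrivial_of_finrank_pos hd
  obtain ⟨q, hq⟩ := exists_ne (0 : (ℝ ∙ x)ᗮ)
  have hq' : (q : E3) ≠ 0 := fun h => hq (Subtype.ext h)
  refine ⟨(‖(q : E3)‖⁻¹ : ℝ) • (q : E3), ?_, ?_⟩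
  · rw [norm_smul, norm_inv, norm_norm, inv_mul_cancel₀ (norm_ne_zero_iff.2 hq')]
  · rw [inner_smul_left, (Submodule.mem_orthogonal_singleton_iff_inner_left.1 q.2), mul_zero]

section
variable {u : ℝ → E3 → E3} {P : ℝ → E3 → ℝ} {T : ℝ}

lemma trace_zero (hu : IsEulerSolutionOn u P T) {t : ℝ} (ht : t ∈ Icc 0 T) (x : E3) :
    fderiv ℝ (u t) x (e3 0) 0 + fderiv ℝ (u t) x (e3 1) 1 + fderiv ℝ (u t) x (e3 2) 2 = 0 := by
  have := hu.incompressible t ht x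
  simpa [div3, pd3, Fin.sum_univ_three] using this

/-- `⟨ω, ξ⟩` is conserved. -/
lemma omega_xi_const (hu : IsEulerSolutionOn u P T) (hT : 0 < T) (γ ξ : ℝ → E3)
    (hγ : ∀ t ∈ Icc 0 T, HasDerivAt γ (u t (γ t)) t)
    (hξ : ∀ t ∈ Icc 0 T, HasDerivAt ξ (-jacT (u t) (γ t) (ξ t)) t) :
    ⟪curl3 (u T) (γ T), ξ T⟫ = ⟪curl3 (u 0) (γ 0), ξ 0⟫ := by
  refine const_of_deriv_zero (f := fun t => ⟪curl3 (u t) (γ t), ξ t⟫) hT ?_ ?_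
  · have hγc : ContinuousOn γ (Icc 0 T) := fun t ht => (hγ t ht).continuousAt.continuousWithinAt
    have hξc : ContinuousOn ξ (Icc 0 T) := fun t ht => (hξ t ht).continuousAt.continuousWithinAt
    have hA : ContinuousOn (fun t => fderiv ℝ (u t) (γ t)) (Icc 0 T) :=
      hu.cont_du.comp_continuousOn (continuousOn_id.prodMk hγc)
    have hAe : ∀ v w : E3, ContinuousOn (fun t => ⟪fderiv ℝ (u t) (γ t) v, w⟫) (Icc 0 T) :=
      fun v w => (hA.clm_apply continuousOn_const).inner continuousOn_const
    have hξi : ∀ i, ContinuousOn (fun t => ξ t i) (Icc 0 T) := fun i =>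
      (EuclideanSpace.proj (𝕜 := ℝ) i).continuous.comp_continuousOn hξc
    have he : (fun t => ⟪curl3 (u t) (γ t), ξ t⟫) = fun t =>
        curl3 (u t) (γ t) 0 * ξ t 0 + curl3 (u t) (γ t) 1 * ξ t 1 + curl3 (u t) (γ t) 2 * ξ t 2 :=
      funext fun t => inner3 _ _
    rw [he]
    simp only [curl3_0, curl3_1, curl3_2]
    exact ((((hAe _ _).sub (hAe _ _)).mul (hξi 0)).add
      (((hAe _ _).sub (hAe _ _)).mul (hξi 1))).add (((hAe _ _).sub (hAe _ _)).mul (hξi 2))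
  · intro t ht
    have ht' : t ∈ Icc 0 T := ⟨ht.1.le, ht.2.le⟩
    have hV := vort_deriv hu γ ht (hγ t ht')
    have hx := hasDerivAt_coord (hξ t ht')
    have htr := trace_zero hu ht' (γ t)
    have hmain := ((((hV (e3 1) (e3 2)).mul (hx 0)).add ((hV (e3 2) (e3 0)).mul (hx 1))).add
      ((hV (e3 0) (e3 1)).mul (hx 2)))
    refine (hmain.congr_deriv ?_).congr_of_eventuallyEq
      (Filter.Eventually.of_forall fun s => ?_)
    · simp only [inner_e3, PiLp.neg_apply, jacT3]
      simp only [clm3 (fderiv ℝ (u t) (γ t)) (fderiv ℝ (u t) (γ t) _)]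
      generalize fderiv ℝ (u t) (γ t) = A at *
      generalize ξ t = z at *
      generalize A (e3 0) 0 = a00 at *
      generalize A (e3 0) 1 = a10 at *
      generalize A (e3 0) 2 = a20 at *
      generalize A (e3 1) 0 = a01 at *
      generalize A (e3 1) 1 = a11 at *
      generalize A (e3 1) 2 = a21 at *
      generalize A (e3 2) 0 = a02 at *
      generalize A (e3 2) 1 = a12 at *
      generalize A (e3 2) 2 = a22 at *
      linear_combination
        (-((a21 - a12) * z 0 + (a02 - a20) * z 1 + (a10 - a01) * z 2)) * htr
    · simp only [inner3, curl3_0, curl3_1, curl3_2, Pi.add_apply, Pi.mul_apply]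

/-- `⟨b, ξ⟩` is conserved. -/
lemma b_xi_const {γ ξ b : ℝ → E3} (hb : IsBicharSolution u T γ ξ b) (h0 : ⟪b 0, ξ 0⟫ = 0) :
    ∀ t ∈ Icc 0 T, ⟪b t, ξ t⟫ = 0 := by
  have hD : ∀ t ∈ Icc 0 T, HasDerivAt (fun t => ⟪b t, ξ t⟫) 0 t := by
    intro t ht
    have h := (hb.hb t ht).inner ℝ (hb.hxi t ht)
    refine h.congr_deriv ?_
    have hz : ‖ξ t‖ ^ 2 ≠ 0 := pow_ne_zero _ (norm_ne_zero_iff.2 (hb.xi_ne t ht))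
    rw [jacT_adj, inner_neg_right, ContinuousLinearMap.adjoint_inner_right, inner_add_left,
      inner_neg_left, inner_smul_left, real_inner_self_eq_norm_sq,
      real_inner_comm (ξ t) (fderiv ℝ (u t) (γ t) (b t))]
    simp only [conj_trivial]
    rw [div_mul_cancel₀ _ hz]
    ring
  intro t ht
  rcases eq_or_lt_of_le ht.1 with h | h
  · rw [← h]; exact h0
  · rw [← h0]
    exact const_of_deriv_zero (f := fun t => ⟪b t, ξ t⟫) h
      (fun s hs => (hD s ⟨hs.1, hs.2.trans ht.2⟩).continuousAt.continuousWithinAt)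
      (fun s hs => hD s ⟨hs.1.le, hs.2.le.trans ht.2⟩)

/-- The triple product `det (b₁, b₂, ξ)` is conserved. -/
lemma det_const (hu : IsEulerSolutionOn u P T) (hT : 0 < T) {γ ξ b c : ℝ → E3}
    (hb : IsBicharSolution u T γ ξ b) (hc : IsBicharSolution u T γ ξ c)
    (hb0 : ⟪b 0, ξ 0⟫ = 0) (hc0 : ⟪c 0, ξ 0⟫ = 0) :
    ⟪b T, cross3 (c T) (ξ T)⟫ = ⟪b 0, cross3 (c 0) (ξ 0)⟫ := by
  have hD : ∀ t ∈ Icc 0 T, HasDerivAt (fun t => ⟪b t, cross3 (c t) (ξ t)⟫) 0 t := by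
    intro t ht
    have h1 := b_xi_const hb hb0 t ht
    have h2 := b_xi_const hc hc0 t ht
    have htr := trace_zero hu ht (γ t)
    have B := hasDerivAt_coord (hb.hb t ht)
    have Z := hasDerivAt_coord (hb.hxi t ht)
    have Y := hasDerivAt_coord (hc.hb t ht)
    have hmain := (((B 0).mul (((Y 1).mul (Z 2)).sub ((Y 2).mul (Z 1)))).add
      ((B 1).mul (((Y 2).mul (Z 0)).sub ((Y 0).mul (Z 2))))).add
      ((B 2).mul (((Y 0).mul (Z 1)).sub ((Y 1).mul (Z 0))))
    refine (hmain.congr_deriv ?_).congr_of_eventuallyEq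
      (Filter.Eventually.of_forall fun s => ?_)
    · generalize (2 * ⟪ξ t, fderiv ℝ (u t) (γ t) (b t)⟫ / ‖ξ t‖ ^ 2) = r1
      generalize (2 * ⟪ξ t, fderiv ℝ (u t) (γ t) (c t)⟫ / ‖ξ t‖ ^ 2) = r2
      simp only [PiLp.neg_apply, PiLp.add_apply, PiLp.smul_apply, smul_eq_mul, jacT3,
        clm3 _ (b t), clm3 _ (c t), Pi.sub_apply, Pi.mul_apply]
      rw [inner3] at h1 h2
      generalize fderiv ℝ (u t) (γ t) = A at *
      generalize A (e3 0) 0 = a00 at *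
      generalize A (e3 0) 1 = a10 at *
      generalize A (e3 0) 2 = a20 at *
      generalize A (e3 1) 0 = a01 at *
      generalize A (e3 1) 1 = a11 at *
      generalize A (e3 1) 2 = a21 at *
      generalize A (e3 2) 0 = a02 at *
      generalize A (e3 2) 1 = a12 at *
      generalize A (e3 2) 2 = a22 at *
      generalize b t 0 = b0 at *
      generalize b t 1 = b1 at *
      generalize b t 2 = b2 at *
      generalize c t 0 = c0 at *
      generalize c t 1 = c1 at *
      generalize c t 2 = c2 at *
      generalize ξ t 0 = z0 at *
      generalize ξ t 1 = z1 at *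
      generalize ξ t 2 = z2 at *
      linear_combination
        (-(b0 * (c1 * z2 - c2 * z1) + b1 * (c2 * z0 - c0 * z2) + b2 * (c0 * z1 - c1 * z0))) * htr
        + ((a21 - a12) * b0 + (a02 - a20) * b1 + (a10 - a01) * b2) * h2
        - ((a21 - a12) * c0 + (a02 - a20) * c1 + (a10 - a01) * c2) * h1
    · simp only [inner3, cross3_0, cross3_1, cross3_2, Pi.add_apply, Pi.mul_apply, Pi.sub_apply]
  exact const_of_deriv_zero (f := fun t => ⟪b t, cross3 (c t) (ξ t)⟫) hT
      (fun s hs => (hD s hs).continuousAt.continuousWithinAt)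
      (fun s hs => hD s ⟨hs.1.le, hs.2.le⟩)

/-- Existence of `γ`, `ξ` with prescribed end data. -/
lemma exists_gamma_xi (hu : IsEulerSolutionOn u P T) (hT : 0 < T) (xT v : E3) (hv : v ≠ 0) :
    ∃ γ ξ : ℝ → E3, γ T = xT ∧ (∃ c : ℝ, 0 < c ∧ ξ T = c • v) ∧ ‖ξ 0‖ = 1 ∧
      (∀ t ∈ Icc 0 T, ξ t ≠ 0) ∧
      (∀ t ∈ Icc 0 T, HasDerivAt γ (u t (γ t)) t) ∧
      (∀ t ∈ Icc 0 T, HasDerivAt ξ (-jacT (u t) (γ t) (ξ t)) t) := by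
  obtain ⟨C, hC⟩ := hu.bdd
  have hC0 : 0 ≤ C := (norm_nonneg _).trans (hC 0 ⟨le_rfl, hT.le⟩ 0).1
  set cl : ℝ → ℝ := fun s => (projIcc 0 T hT.le s : ℝ) with hcl
  have hclc : Continuous cl := continuous_subtype_val.comp continuous_projIcc
  have hclm : ∀ s, cl s ∈ Icc 0 T := fun s => (projIcc 0 T hT.le s).2
  have hcle : ∀ s ∈ Icc 0 T, cl s = s := fun s hs => by simp [hcl, projIcc_of_mem hT.le hs]
  obtain ⟨γ, hγT, hγ⟩ := ode_bdd T hT (fun t x => u (cl t) x) ⟨C, hC0⟩ ⟨C, hC0⟩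
    (fun x => hu.cont_u.comp (hclc.prodMk continuous_const))
    (fun t => lipschitzWith_of_nnnorm_fderiv_le
      (fun x => (diff_u hu (cl t) x).differentiableAt) (fun x => (hC _ (hclm t) x).2.1))
    (fun t x => (hC _ (hclm t) x).1) T ⟨hT.le, le_rfl⟩ xT
  replace hγ : ∀ t ∈ Icc 0 T, HasDerivAt γ (u t (γ t)) t := fun t ht => by
    have := hγ t ht
    simpa only [hcle t ht] using this
  have hγc : ContinuousOn γ (Icc 0 T) := fun t ht => (hγ t ht).continuousAt.continuousWithinAt
  have hγcl : Continuous fun t => γ (cl t) := hγc.comp_continuous hclc hclm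
  have hA : Continuous fun t => fderiv ℝ (u (cl t)) (γ (cl t)) :=
    hu.cont_du.comp (hclc.prodMk hγcl)
  obtain ⟨y, hyT, hy, hy0⟩ := ode_lin_back T hT
    (fun t => -ContinuousLinearMap.adjoint (fderiv ℝ (u (cl t)) (γ (cl t))))
    ((ContinuousLinearMap.adjoint.continuous.comp hA).neg) ⟨C, hC0⟩
    (fun t => by
      rw [norm_neg, LinearIsometryEquiv.norm_map]
      exact (hC _ (hclm t) _).2.1) v hv
  have hn : 0 < ‖y 0‖ := norm_pos_iff.2 (hy0 0 ⟨le_rfl, hT.le⟩)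
  refine ⟨γ, fun t => ‖y 0‖⁻¹ • y t, hγT, ⟨‖y 0‖⁻¹, by positivity, by simp only [hyT]⟩, ?_, ?_, hγ, ?_⟩
  · rw [norm_smul, norm_inv, norm_norm, inv_mul_cancel₀ hn.ne']
  · intro t ht
    exact smul_ne_zero (inv_ne_zero hn.ne') (hy0 t ht)
  · intro t ht
    have h1 := (hy t ht).const_smul (‖y 0‖⁻¹)
    simp only [hcle t ht] at h1
    refine h1.congr_deriv ?_
    rw [jacT_adj, map_smul, neg_apply, smul_neg]

/-- Existence of amplitudes. -/
lemma exists_b (hu : IsEulerSolutionOn u P T) (hT : 0 < T) {γ ξ : ℝ → E3}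
    (hξ0 : ∀ t ∈ Icc 0 T, ξ t ≠ 0)
    (hγ : ∀ t ∈ Icc 0 T, HasDerivAt γ (u t (γ t)) t)
    (hξ : ∀ t ∈ Icc 0 T, HasDerivAt ξ (-jacT (u t) (γ t) (ξ t)) t) (p : E3) :
    ∃ b : ℝ → E3, b 0 = p ∧ IsBicharSolution u T γ ξ b := by
  set cl : ℝ → ℝ := fun s => (projIcc 0 T hT.le s : ℝ) with hcl
  have hclc : Continuous cl := continuous_subtype_val.comp continuous_projIcc
  have hclm : ∀ s, cl s ∈ Icc 0 T := fun s => (projIcc 0 T hT.le s).2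
  have hcle : ∀ s ∈ Icc 0 T, cl s = s := fun s hs => by simp [hcl, projIcc_of_mem hT.le hs]
  have hγc : ContinuousOn γ (Icc 0 T) := fun t ht => (hγ t ht).continuousAt.continuousWithinAt
  have hξc : ContinuousOn ξ (Icc 0 T) := fun t ht => (hξ t ht).continuousAt.continuousWithinAt
  have hγcl : Continuous fun t => γ (cl t) := hγc.comp_continuous hclc hclm
  have hξcl : Continuous fun t => ξ (cl t) := hξc.comp_continuous hclc hclm
  have hA : Continuous fun t => fderiv ℝ (u (cl t)) (γ (cl t)) :=
    hu.cont_du.comp (hclc.prodMk hγcl)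
  set M : ℝ → E3 →L[ℝ] E3 := fun t => -fderiv ℝ (u (cl t)) (γ (cl t)) +
    (2 / ‖ξ (cl t)‖ ^ 2) • ((innerSL ℝ (ξ (cl t))).comp
      (fderiv ℝ (u (cl t)) (γ (cl t)))).smulRight (ξ (cl t)) with hMdef
  have hM : Continuous M := by
    have hs1 : Continuous fun t => 2 / ‖ξ (cl t)‖ ^ 2 := by
      refine continuous_const.div (hξcl.norm.pow 2) fun t => ?_
      exact pow_ne_zero _ (norm_ne_zero_iff.2 (hξ0 _ (hclm t)))
    have hs2 : Continuous fun t => ((innerSL ℝ (ξ (cl t))).comp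
      (fderiv ℝ (u (cl t)) (γ (cl t)))).smulRight (ξ (cl t)) := by
      have h1 : Continuous fun t => (innerSL ℝ (ξ (cl t))).comp
          (fderiv ℝ (u (cl t)) (γ (cl t))) :=
        ((innerSL ℝ).continuous.comp hξcl).clm_comp hA
      have h2 := ((ContinuousLinearMap.smulRightL ℝ E3 E3).continuous.comp h1).clm_apply hξcl
      exact h2
    exact hA.neg.add (hs1.smul hs2)
  obtain ⟨C, hC⟩ := isCompact_Icc.exists_bound_of_continuousOn hM.continuousOn (s := Icc 0 T)
  have hMcl : ∀ t, M (cl t) = M t := by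
    intro t
    simp only [hMdef, hcle _ (hclm t)]
  have hC0 : 0 ≤ C := (norm_nonneg _).trans (hC 0 ⟨le_rfl, hT.le⟩)
  obtain ⟨b, hb0, hb⟩ := ode_lin T hT M hM ⟨C, hC0⟩
    (fun t => by rw [← hMcl]; exact hC _ (hclm t)) p
  refine ⟨b, hb0, hξ0, hγ, hξ, fun t ht => (hb t ht).congr_deriv ?_⟩
  simp only [hMdef, hcle t ht]
  simp [smul_smul]
  congr 1
  ring
end

/-- (Proposition 1.) For a smooth bounded Euler solution on `[0,T] × ℝ³`
with `0 < ‖ω⁰‖_{L^∞} < ∞`, for every `x_T ∈ ℝ³` there is a solution `(γ, ξ, b)` of the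
bicharacteristic-amplitude system along `u` with `|ξ(0)| = |b(0)| = 1`, `⟨b(0), ξ(0)⟩ = 0`
and `|b(T)|² ‖ω⁰‖_{L^∞} ≥ |ω(T, x_T)|`.  (This expresses
`sup_x √(|ω(T,x)|/‖ω⁰‖_{L^∞}) ≤ β(T)`.) -/
theorem stmt2 (T : ℝ) (hT : 0 < T)
    (u : ℝ → E3 → E3) (P : ℝ → E3 → ℝ) (hu : IsEulerSolutionOn u P T)
    (hω0pos : 0 < ⨆ x : E3, (‖curl3 (u 0) x‖₊ : ℝ≥0∞))
    (hω0fin : (⨆ x : E3, (‖curl3 (u 0) x‖₊ : ℝ≥0∞)) < ∞)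
    (xT : E3) :
    ∃ γ ξ b : ℝ → E3,
      IsBicharSolution u T γ ξ b ∧
      ‖ξ 0‖ = 1 ∧ ‖b 0‖ = 1 ∧ ⟪b 0, ξ 0⟫ = 0 ∧
      ‖curl3 (u T) xT‖ ≤
        ‖b T‖ ^ 2 * (⨆ x : E3, (‖curl3 (u 0) x‖₊ : ℝ≥0∞)).toReal := by
  obtain ⟨v, hv, hvω⟩ : ∃ v : E3, v ≠ 0 ∧
      ⟪curl3 (u T) xT, v⟫ = ‖curl3 (u T) xT‖ * ‖v‖ := by
    by_cases h : curl3 (u T) xT = 0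
    · refine ⟨e3 0, ?_, by simp [h]⟩
      simp [e3]
    · exact ⟨_, h, by rw [real_inner_self_eq_norm_sq, sq]⟩
  obtain ⟨γ, ξ, hγT, ⟨c, hc, hξT⟩, hξ1, hξ0, hγ, hξ⟩ := exists_gamma_xi hu hT xT v hv
  have hω := omega_xi_const hu hT γ ξ hγ hξ
  set S := (⨆ x : E3, (‖curl3 (u 0) x‖₊ : ℝ≥0∞)).toReal with hS
  have hsup : ‖curl3 (u 0) (γ 0)‖ ≤ S := by
    have h1 : (‖curl3 (u 0) (γ 0)‖₊ : ℝ≥0∞) ≤ ⨆ x : E3, (‖curl3 (u 0) x‖₊ : ℝ≥0∞) :=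
      le_iSup (fun x : E3 => (‖curl3 (u 0) x‖₊ : ℝ≥0∞)) (γ 0)
    have h2 := ENNReal.toReal_mono hω0fin.ne h1
    simpa using h2
  have hωξ : ‖curl3 (u T) xT‖ * ‖ξ T‖ ≤ S := by
    have h1 : ‖curl3 (u T) xT‖ * ‖ξ T‖ = ⟪curl3 (u T) (γ T), ξ T⟫ := by
      rw [hγT, hξT, norm_smul, inner_smul_right, hvω, Real.norm_eq_abs, abs_of_pos hc]
      ring
    rw [h1, hω]
    refine (real_inner_le_norm _ _).trans ?_
    rw [hξ1, mul_one]
    exact hsup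
  obtain ⟨p, hp1, hp⟩ := exists_perp (ξ 0) hξ1
  obtain ⟨b, hb0, hb⟩ := exists_b hu hT hξ0 hγ hξ p
  obtain ⟨d, hd0, hd⟩ := exists_b hu hT hξ0 hγ hξ (cross3 (ξ 0) p)
  have hp3 := hp
  rw [inner3] at hp3
  have hps : ‖p‖ ^ 2 = 1 := by rw [hp1]; norm_num
  have hxs : ‖ξ 0‖ ^ 2 = 1 := by rw [hξ1]; norm_num
  rw [normsq3] at hps hxs
  have hd1 : ‖d 0‖ = 1 := by
    have : ‖d 0‖ ^ 2 = 1 := by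
      rw [hd0, normsq3, cross3_0, cross3_1, cross3_2]
      linear_combination (ξ 0 0 * ξ 0 0 + ξ 0 1 * ξ 0 1 + ξ 0 2 * ξ 0 2) * hps + hxs
        - (p 0 * ξ 0 0 + p 1 * ξ 0 1 + p 2 * ξ 0 2) * hp3
    exact (pow_eq_one_iff_of_nonneg (norm_nonneg _) (by norm_num)).1 this
  have hdξ : ⟪d 0, ξ 0⟫ = 0 := by
    rw [hd0, inner3, cross3_0, cross3_1, cross3_2]
    ring
  have hbξ : ⟪b 0, ξ 0⟫ = 0 := by rw [hb0]; exact hp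
  have hdet := det_const hu hT hb hd hbξ hdξ
  have hdet0 : ⟪b 0, cross3 (d 0) (ξ 0)⟫ = 1 := by
    rw [hb0, hd0]
    simp only [inner3, cross3_0, cross3_1, cross3_2]
    linear_combination (ξ 0 0 * ξ 0 0 + ξ 0 1 * ξ 0 1 + ξ 0 2 * ξ 0 2) * hps + hxs
        - (p 0 * ξ 0 0 + p 1 * ξ 0 1 + p 2 * ξ 0 2) * hp3
  have hone : 1 ≤ ‖b T‖ * (‖d T‖ * ‖ξ T‖) := by
    rw [← hdet0, ← hdet]
    refine (real_inner_le_norm _ _).trans ?_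
    exact mul_le_mul_of_nonneg_left (norm_cross_le _ _) (norm_nonneg _)
  have key : ∀ β : ℝ, 1 ≤ β ^ 2 * ‖ξ T‖ → ‖curl3 (u T) xT‖ ≤ β ^ 2 * S := by
    intro β hβ
    calc ‖curl3 (u T) xT‖ ≤ ‖curl3 (u T) xT‖ * (β ^ 2 * ‖ξ T‖) :=
          le_mul_of_one_le_right (norm_nonneg _) hβ
      _ = β ^ 2 * (‖curl3 (u T) xT‖ * ‖ξ T‖) := by ring
      _ ≤ β ^ 2 * S := mul_le_mul_of_nonneg_left hωξ (sq_nonneg _)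
  rcases le_total ‖d T‖ ‖b T‖ with h | h
  · refine ⟨γ, ξ, b, hb, hξ1, by rw [hb0, hp1], hbξ, key _ (hone.trans ?_)⟩
    rw [sq, mul_assoc]
    gcongr
  · refine ⟨γ, ξ, d, hd, hξ1, hd1, hdξ, key _ (hone.trans ?_)⟩
    rw [sq, mul_assoc]
    gcongr
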